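/- Let N and k be natural numbers with 2k ≤ N. The number of involutions in the symmetric group S_N whose cycle decomposition contains exactly k transpositions (equivalently, permutations π of a set of N elements with π ∘ π = id whose support has cardinality 2k) equals (2k−1)!! · C(N, 2k), where (2k−1)!! denotes the double factorial and C(N, 2k) the binomial coefficient. -/

import Mathlib

lemma invol_iff_cycleType {N k : ℕ} (π : Equiv.Perm (Fin N)) :
    (π * π = 1 ∧ π.support.card = 2 * k) ↔ π.cycleType = Multiset.replicate k 2 := by
  rw [← pow_two, ← Equiv.Perm.sum_cycleType]
  constructor
  · rintro ⟨h1, h2⟩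
    have h3 := Equiv.Perm.cycleType_of_pow_prime_eq_one h1
    rw [h3, Multiset.sum_replicate, smul_eq_mul] at h2
    rw [h3]
    congr 1
    omega
  · intro h
    refine ⟨Equiv.Perm.pow_prime_eq_one_iff.mpr ?_, ?_⟩
    · intro c hc
      rw [h] at hc
      exact Multiset.eq_of_mem_replicate hc
    · rw [h, Multiset.sum_replicate, smul_eq_mul, mul_comm]

lemma two_mul_factorial_split (k : ℕ) :
    (2 * k).factorial = Nat.doubleFactorial (2 * k - 1) * (2 ^ k * k.factorial) := by
  cases k with
  | zero => rfl
  | succ n =>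
    rw [← Nat.doubleFactorial_two_mul, mul_comm (Nat.doubleFactorial _)]
    exact Nat.factorial_eq_mul_doubleFactorial (2 * n + 1)

/-- The number of involutions in the symmetric group `S_N` whose cycle decomposition
contains exactly `k` transpositions (i.e. permutations `π` with `π ∘ π = id` whose
support has cardinality `2 * k`) equals `(2k-1)‼ * C(N, 2k)`. -/
theorem count_involutions_with_k_transpositions (N k : ℕ) (h : 2 * k ≤ N) :
    Nat.card {π : Equiv.Perm (Fin N) // π * π = 1 ∧ π.support.card = 2 * k} =
      Nat.doubleFactorial (2 * k - 1) * N.choose (2 * k) := by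
  have key := Equiv.Perm.card_of_cycleType_mul_eq (Fin N) (Multiset.replicate k 2)
  have hprod : (∏ n ∈ (Multiset.replicate k 2).toFinset,
      ((Multiset.replicate k 2).count n).factorial) = k.factorial := by
    rcases Nat.eq_zero_or_pos k with rfl | hk
    · simp
    · rw [Multiset.toFinset_replicate, if_neg hk.ne']
      simp
  rw [hprod, if_pos ⟨by simpa [mul_comm] using h,
    fun a ha => (Multiset.eq_of_mem_replicate ha).ge⟩, Multiset.sum_replicate,
    Multiset.prod_replicate, smul_eq_mul, Fintype.card_fin, mul_comm k 2] at key
  simp_rw [invol_iff_cycleType]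
  rw [Nat.card_eq_fintype_card, Fintype.card_subtype]
  have hc := Nat.choose_mul_factorial_mul_factorial h
  rw [two_mul_factorial_split k] at hc
  have hpos : 0 < (N - 2 * k).factorial * 2 ^ k * k.factorial := by positivity
  apply Nat.eq_of_mul_eq_mul_right hpos
  rw [key, ← hc]
  ring
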